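/- The category of partitions ⟨π_l, l ∈ ℕ⟩ is not finitely generated: there are no finitely many partitions p₁,…,pₙ with ⟨π_l, l ∈ ℕ⟩ = ⟨p₁,…,pₙ⟩. -/

import Mathlib

/-!
Basic combinatorics of categories of partitions (Banica–Speicher easy quantum groups).

A partition with `k` upper and `l` lower points is encoded as an equivalence
relation (a `Setoid`) on the set `Fin k ⊕ Fin l` of its points; its blocks are
the equivalence classes.
-/

namespace EasyQG

/-- A partition of `k` upper and `l` lower points into blocks. -/
abbrev Partition (k l : ℕ) : Type := Setoid (Fin k ⊕ Fin l)

/-- The relation "lying in the same block" of a partition. -/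
def inSameBlock {k l : ℕ} (p : Partition k l) :
    (Fin k ⊕ Fin l) → (Fin k ⊕ Fin l) → Prop :=
  @Setoid.r _ p

/-- The partition in `P(0,n)` associated to a word: two points lie in the same
block iff they carry the same letter. -/
def ofWord {n : ℕ} (w : Fin n → ℕ) : Partition 0 n :=
  Setoid.ker (Sum.elim Fin.elim0 w)

/-- The partition in `P(0,n)` associated to a word given as a list of letters. -/
def ofList (w : List ℕ) : Partition 0 w.length :=
  ofWord w.get

/-- The identity partition `|` in `P(1,1)`: one upper point joined to one lower point. -/
def idPartition : Partition 1 1 := ⊤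

/-- The pair partition `⊓` in `P(0,2)`: two points in one block. -/
def pairPartition : Partition 0 2 := ⊤

/-- The double singleton `↓⊗↓` in `P(0,2)`: two points in two different blocks. -/
def doubleSingleton : Partition 0 2 := ⊥

/-- The four block partition `⊓⊓` in `P(0,4)`: four points in one block (word `aaaa`). -/
def fourBlock : Partition 0 4 := ⊤

/-- The fat crossing partition in `P(4,4)`, with blocks `{1,2,3',4'}` and `{3,4,1',2'}`. -/
def fatCross : Partition 4 4 :=
  Setoid.ker (Sum.elim (fun i => decide (i.val < 2)) (fun j => decide (2 ≤ j.val)))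

/-- The pair positioner partition in `P(3,3)`, with blocks `{1,2,2',3'}` and `{3,1'}`. -/
def pairPositioner : Partition 3 3 :=
  Setoid.ker (Sum.elim (fun i => decide (i.val < 2)) (fun j => decide (1 ≤ j.val)))

/-- The `s`-mixing partition `h_s ∈ P(0,2s)`, the word `abab…ab` of length `2s`. -/
def sMixing (s : ℕ) : Partition 0 (2 * s) := ofWord (fun i => i.val % 2)

/-- The partition `π_k ∈ P(0,4k)`, the word `a₁…a_k a_k…a₁ a₁…a_k a_k…a₁`
in `k` distinct letters. -/
def piPartition (k : ℕ) : Partition 0 (4 * k) :=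
  ofWord (fun i =>
    if i.val % (2 * k) < k then i.val % (2 * k) else 2 * k - 1 - i.val % (2 * k))

/-- The disjoint sum of two set partitions. -/
def sumSetoid {α β : Type*} (ra : Setoid α) (rb : Setoid β) : Setoid (α ⊕ β) where
  r := Sum.LiftRel (@Setoid.r _ ra) (@Setoid.r _ rb)
  iseqv := by
    constructor
    · intro x
      cases x with
      | inl a => exact Sum.LiftRel.inl (ra.iseqv.refl a)
      | inr b => exact Sum.LiftRel.inr (rb.iseqv.refl b)
    · intro x y h
      cases h with
      | inl h => exact Sum.LiftRel.inl (ra.iseqv.symm h)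
      | inr h => exact Sum.LiftRel.inr (rb.iseqv.symm h)
    · intro x y z h1 h2
      cases h1 with
      | inl h1 => cases h2 with
        | inl h2 => exact Sum.LiftRel.inl (ra.iseqv.trans h1 h2)
      | inr h1 => cases h2 with
        | inr h2 => exact Sum.LiftRel.inr (rb.iseqv.trans h1 h2)

/-- Tensor product (horizontal concatenation) of partitions. -/
def tensor {k l k' l' : ℕ} (p : Partition k l) (q : Partition k' l') :
    Partition (k + k') (l + l') :=
  Setoid.comap
    (fun x => (Equiv.sumSumSumComm (Fin k) (Fin k') (Fin l) (Fin l'))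
      (Sum.map finSumFinEquiv.symm finSumFinEquiv.symm x))
    (sumSetoid p q)

/-- Composition (vertical concatenation) of partitions `p ∈ P(k,l)` and `q ∈ P(l,m)`:
blocks are joined along the `l` middle points, which are then deleted. -/
def comp {k l m : ℕ} (p : Partition k l) (q : Partition l m) : Partition k m :=
  Setoid.comap (Sum.map id Sum.inr)
    (Relation.EqvGen.setoid (fun x y : Fin k ⊕ (Fin l ⊕ Fin m) =>
      (∃ a b, inSameBlock p a b ∧ Sum.map id Sum.inl a = x ∧ Sum.map id Sum.inl b = y) ∨
      (∃ a b, inSameBlock q a b ∧ Sum.inr a = x ∧ Sum.inr b = y)))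

/-- Involution (turning a partition upside down). -/
def involution {k l : ℕ} (p : Partition k l) : Partition l k :=
  Setoid.comap Sum.swap p

/-- Rotation moving the leftmost upper point to the left end of the lower row. -/
def rotUL {k l : ℕ} (p : Partition (k + 1) l) : Partition k (l + 1) :=
  Setoid.comap
    (Sum.elim (fun i => Sum.inl i.succ)
      (fun j => Fin.cases (Sum.inl (0 : Fin (k + 1))) (fun j' => Sum.inr j') j)) p

/-- Rotation moving the leftmost lower point to the left end of the upper row. -/
def rotLU {k l : ℕ} (p : Partition k (l + 1)) : Partition (k + 1) l :=
  Setoid.comap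
    (Sum.elim (fun i => Fin.cases (Sum.inr (0 : Fin (l + 1))) (fun i' => Sum.inl i') i)
      (fun j => Sum.inr j.succ)) p

/-- Rotation moving the rightmost upper point to the right end of the lower row. -/
def rotUR {k l : ℕ} (p : Partition (k + 1) l) : Partition k (l + 1) :=
  Setoid.comap
    (Sum.elim (fun i => Sum.inl i.castSucc)
      (fun j => Fin.lastCases (Sum.inl (Fin.last k)) (fun j' => Sum.inr j') j)) p

/-- Rotation moving the rightmost lower point to the right end of the upper row. -/
def rotRU {k l : ℕ} (p : Partition k (l + 1)) : Partition (k + 1) l :=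
  Setoid.comap
    (Sum.elim (fun i => Fin.lastCases (Sum.inr (Fin.last l)) (fun i' => Sum.inl i') i)
      (fun j => Sum.inr j.castSucc)) p

/-- A category of partitions: a collection of partitions containing the identity
partition and closed under the category operations (tensor product, composition,
involution and the four rotations). -/
structure PartitionCategory where
  mem : Set (Σ k l : ℕ, Partition k l)
  id_mem : ⟨1, 1, idPartition⟩ ∈ mem
  tensor_mem : ∀ {k l k' l' : ℕ} {p : Partition k l} {q : Partition k' l'},
    ⟨k, l, p⟩ ∈ mem → ⟨k', l', q⟩ ∈ mem → ⟨k + k', l + l', tensor p q⟩ ∈ mem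
  comp_mem : ∀ {k l m : ℕ} {p : Partition k l} {q : Partition l m},
    ⟨k, l, p⟩ ∈ mem → ⟨l, m, q⟩ ∈ mem → ⟨k, m, comp p q⟩ ∈ mem
  involution_mem : ∀ {k l : ℕ} {p : Partition k l},
    ⟨k, l, p⟩ ∈ mem → ⟨l, k, involution p⟩ ∈ mem
  rotUL_mem : ∀ {k l : ℕ} {p : Partition (k + 1) l},
    ⟨k + 1, l, p⟩ ∈ mem → ⟨k, l + 1, rotUL p⟩ ∈ mem
  rotLU_mem : ∀ {k l : ℕ} {p : Partition k (l + 1)},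
    ⟨k, l + 1, p⟩ ∈ mem → ⟨k + 1, l, rotLU p⟩ ∈ mem
  rotUR_mem : ∀ {k l : ℕ} {p : Partition (k + 1) l},
    ⟨k + 1, l, p⟩ ∈ mem → ⟨k, l + 1, rotUR p⟩ ∈ mem
  rotRU_mem : ∀ {k l : ℕ} {p : Partition k (l + 1)},
    ⟨k, l + 1, p⟩ ∈ mem → ⟨k + 1, l, rotRU p⟩ ∈ mem

/-- The members of the smallest category of partitions containing `S`
(the category `⟨S⟩` generated by `S`). -/
def generated (S : Set (Σ k l : ℕ, Partition k l)) : Set (Σ k l : ℕ, Partition k l) :=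
  {x | ∀ C : PartitionCategory, S ⊆ C.mem → x ∈ C.mem}

/-- A category of partitions is hyperoctahedral if it contains the four block
partition `⊓⊓` but not the double singleton `↓⊗↓`. -/
def Hyperoctahedral (C : PartitionCategory) : Prop :=
  (⟨0, 4, fourBlock⟩ : Σ k l : ℕ, Partition k l) ∈ C.mem ∧
    (⟨0, 2, doubleSingleton⟩ : Σ k l : ℕ, Partition k l) ∉ C.mem

/-- A category of partitions is group-theoretical if it contains the pair
positioner partition. -/
def GroupTheoretical (C : PartitionCategory) : Prop :=
  (⟨3, 3, pairPositioner⟩ : Σ k l : ℕ, Partition k l) ∈ C.mem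

/-- The generating set `{π_l | 1 ≤ l ≤ k}`. -/
def piUpTo (k : ℕ) : Set (Σ k l : ℕ, Partition k l) :=
  {x | ∃ l : ℕ, 1 ≤ l ∧ l ≤ k ∧ x = ⟨0, 4 * l, piPartition l⟩}

/-- The generating set `{π_l | l ∈ ℕ, l ≥ 1}`. -/
def piAll : Set (Σ k l : ℕ, Partition k l) :=
  {x | ∃ l : ℕ, 1 ≤ l ∧ x = ⟨0, 4 * l, piPartition l⟩}

end EasyQG
namespace EasyQG

/-- Merging the blocks of the points `x` and `y` of a partition. -/
def merge {k l : ℕ} (p : Partition k l) (x y : Fin k ⊕ Fin l) : Partition k l :=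
  Relation.EqvGen.setoid (fun u v => inSameBlock p u v ∨ (u = x ∧ v = y) ∨ (u = y ∧ v = x))

/-- The word `a_{i(1)}^{k(1)} … a_{i(m)}^{k(m)}` determined by a list of
letters with exponents. -/
def expand (blocks : List (ℕ × ℕ)) : List ℕ :=
  (blocks.map fun be => List.replicate be.2 be.1).flatten

/-- The run decomposition of a word: the list of its (letter, exponent) blocks. -/
def runs : List ℕ → List (ℕ × ℕ)
  | [] => []
  | a :: rest =>
    match runs rest with
    | [] => [(a, 1)]
    | (b, e) :: rs => if a = b then (b, e + 1) :: rs else (a, 1) :: (b, e) :: rs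

/-- The single-double leg form associated to a word: every odd exponent is
replaced by `1` and every even exponent by `2`. -/
def sdForm (w : List ℕ) : List ℕ :=
  expand ((runs w).map fun be => (be.1, if Odd be.2 then 1 else 2))

/-- A word is in single-double leg form if all its exponents are `1` or `2`. -/
def IsSingleDoubleLegForm (w : List ℕ) : Prop :=
  ∃ blocks : List (ℕ × ℕ), List.Chain' (fun x y => x.1 ≠ y.1) blocks ∧
    (∀ b ∈ blocks, b.2 = 1 ∨ b.2 = 2) ∧ w = expand blocks

/-- The vertical reflection of a partition: the left-to-right order of the
points is reversed in both rows, keeping the block structure. -/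
def verticalReflect {k l : ℕ} (p : Partition k l) : Partition k l :=
  Setoid.comap (Sum.map Fin.rev Fin.rev) p

/-- `leg [a₁,…,a_k] [X₁,…,X_{k-1}] = a₁ X₁ a₂ X₂ … a_{k-1} X_{k-1} a_k`:
a list of letters interleaved with filler words. -/
def leg : List ℕ → List (List ℕ) → List ℕ
  | [], _ => []
  | [a], _ => [a]
  | a :: rest, Xs => a :: (Xs.headD [] ++ leg rest Xs.tail)

/-- A word contains a W of depth `k` if it can be written as
`Y₁ S_α X_k^α S_β Y₂ S_γ X_k^γ S_δ Y₃`, where `S_α = a₁X₁^α a₂X₂^α…a_k`,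
`S_β = a_k X_{k-1}^β…X₁^β a₁`, `S_γ = a₁X₁^γ…a_k`, `S_δ = a_k X_{k-1}^δ…X₁^δ a₁`
for `k` distinct letters `a₁,…,a_k`, each of which occurs an odd number of
times in each of `S_α`, `S_β`, `S_γ`, `S_δ`. -/
def ContainsW (w : List ℕ) (k : ℕ) : Prop :=
  ∃ (as : List ℕ) (Xa Xb Xc Xd : List (List ℕ)) (Xka Xkc Y1 Y2 Y3 : List ℕ),
    as.length = k ∧ as.Nodup ∧
    Xa.length = k - 1 ∧ Xb.length = k - 1 ∧ Xc.length = k - 1 ∧ Xd.length = k - 1 ∧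
    w = Y1 ++ leg as Xa ++ Xka ++ leg as.reverse Xb ++ Y2 ++
        leg as Xc ++ Xkc ++ leg as.reverse Xd ++ Y3 ∧
    ∀ a ∈ as, Odd ((leg as Xa).count a) ∧ Odd ((leg as.reverse Xb).count a) ∧
      Odd ((leg as Xc).count a) ∧ Odd ((leg as.reverse Xd).count a)

/-- `wdepth w` is the maximal `k` such that some rotated version of the
word `w` contains a W of depth `k`. -/
noncomputable def wdepth (w : List ℕ) : ℕ :=
  sSup {k | ∃ r : ℕ, ContainsW (w.rotate r) k}

end EasyQG

namespace EasyQG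

open Matrix

set_option linter.all false

section Model

variable {X A : Type} [Fintype X] [DecidableEq X] [Ring A] [StarRing A] (u : X → X → A)

/-- The tensor power of the matrix `u`. -/
def UU (n : ℕ) : Matrix (Fin n → X) (Fin n → X) A :=
  fun x y => (List.ofFn fun m => u (x m) (y m)).prod

/-- The labelling `(i, t)` is constant on the blocks of `p`. -/
def Resp {k l : ℕ} (p : Partition k l) (i : Fin k → X) (t : Fin l → X) : Prop :=
  p ≤ Setoid.ker (Sum.elim i t)

open Classical in
/-- The linear map associated to a partition. -/
noncomputable def TT (X A : Type) [Ring A] {k l : ℕ} (p : Partition k l) :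
    Matrix (Fin l → X) (Fin k → X) A :=
  fun t i => if Resp p i t then 1 else 0

theorem TT_pos {k l : ℕ} {p : Partition k l} {i : Fin k → X} {t : Fin l → X} (h : Resp p i t) :
    TT X A p t i = 1 := if_pos h

theorem TT_neg {k l : ℕ} {p : Partition k l} {i : Fin k → X} {t : Fin l → X} (h : ¬ Resp p i t) :
    TT X A p t i = 0 := if_neg h

theorem TT_congr {k l k' l' : ℕ} {p : Partition k l} {i : Fin k → X} {t : Fin l → X}
    {q : Partition k' l'} {i' : Fin k' → X} {t' : Fin l' → X} (h : Resp p i t ↔ Resp q i' t') :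
    TT X A p t i = TT X A q t' i' := by
  by_cases h1 : Resp p i t
  · rw [TT_pos h1, TT_pos (h.1 h1)]
  · rw [TT_neg h1, TT_neg (fun h2 => h1 (h.2 h2))]

/-- The intertwiner relation. -/
def RR {k l : ℕ} (p : Partition k l) : Prop :=
  UU u l * TT X A p = TT X A p * UU u k

theorem UU_cons {n : ℕ} (x y : Fin (n + 1) → X) :
    UU u (n + 1) x y = u (x 0) (y 0) * UU u n (Fin.tail x) (Fin.tail y) := by
  simp [UU, List.ofFn_succ, Fin.tail]

theorem UU_snoc {n : ℕ} (x y : Fin (n + 1) → X) :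
    UU u (n + 1) x y = UU u n (Fin.init x) (Fin.init y) * u (x (Fin.last n)) (y (Fin.last n)) := by
  simp only [UU]
  rw [List.ofFn_succ', List.concat_eq_append, List.prod_append]
  simp [Fin.init]

theorem UU_append {m n : ℕ} (x y : Fin (m + n) → X) :
    UU u (m + n) x y = UU u m (fun i => x (Fin.castAdd n i)) (fun i => y (Fin.castAdd n i)) *
      UU u n (fun i => x (Fin.natAdd m i)) (fun i => y (Fin.natAdd m i)) := by
  simp [UU, List.ofFn_add]
  rfl

theorem resp_comap {k l k' l' : ℕ} (p : Partition k l) (f : Fin k' ⊕ Fin l' → Fin k ⊕ Fin l)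
    (g : Fin k ⊕ Fin l → Fin k' ⊕ Fin l') (hfg : ∀ x, f (g x) = x) (hgf : ∀ x, g (f x) = x)
    (i : Fin k' → X) (t : Fin l' → X) (i' : Fin k → X) (t' : Fin l → X)
    (h : ∀ x, Sum.elim i t x = Sum.elim i' t' (f x)) :
    Resp (Setoid.comap f p) i t ↔ Resp p i' t' := by
  constructor
  · intro H x y hxy
    have := @H (g x) (g y) (by simpa [Setoid.comap_rel, hfg] using hxy)
    simpa [Setoid.ker_def, h, hfg] using this
  · intro H x y hxy
    have := @H (f x) (f y) (by simpa [Setoid.comap_rel, hfg] using hxy)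
    simpa [Setoid.ker_def, h, hfg] using this

/-- Orthogonality. -/
structure Orth : Prop where
  sa : ∀ i j, star (u i j) = u i j
  row : ∀ i k, ∑ j, u i j * u k j = if i = k then 1 else 0
  col : ∀ j k, ∑ i, u i j * u i k = if j = k then 1 else 0

variable {u}

theorem sum_cons {n : ℕ} (f : (Fin (n + 1) → X) → A) :
    ∑ x, f x = ∑ a, ∑ x : Fin n → X, f (Fin.cons a x) := by
  rw [← (Fin.consEquiv (fun _ => X)).sum_comp, Fintype.sum_prod_type]
  rfl

theorem sum_snoc {n : ℕ} (f : (Fin (n + 1) → X) → A) :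
    ∑ x, f x = ∑ x : Fin n → X, ∑ a, f (Fin.snoc x a) := by
  rw [← (Fin.snocEquiv (fun _ => X)).sum_comp, Fintype.sum_prod_type, Finset.sum_comm]
  rfl

theorem sum_append {m n : ℕ} (f : (Fin (m + n) → X) → A) :
    ∑ x, f x = ∑ x : Fin m → X, ∑ y : Fin n → X, f (Fin.append x y) := by
  rw [← (Fin.appendEquiv m n).sum_comp, Fintype.sum_prod_type]
  rfl

theorem UU_mul_star (h : Orth u) (n : ℕ) : UU u n * (UU u n)ᴴ = 1 := by
  induction n with
  | zero =>
    ext x y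
    have : x = y := Subsingleton.elim _ _
    simp [Matrix.mul_apply, Matrix.one_apply, UU, this]
  | succ n ih =>
    ext x y
    rw [Matrix.mul_apply, sum_snoc]
    have : ∀ (t : Fin n → X), ∑ a, UU u (n+1) x (Fin.snoc t a) * (UU u (n+1))ᴴ (Fin.snoc t a) y
        = UU u n (Fin.init x) t * (if x (Fin.last n) = y (Fin.last n) then 1 else 0) *
          star (UU u n (Fin.init y) t) := by
      intro t
      rw [← h.row, Finset.mul_sum, Finset.sum_mul]
      refine Finset.sum_congr rfl fun a _ => ?_
      rw [Matrix.conjTranspose_apply, UU_snoc, UU_snoc]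
      simp [h.sa, mul_assoc]
    simp_rw [this]
    have ih' := congrFun (congrFun ih (Fin.init x)) (Fin.init y)
    rw [Matrix.mul_apply] at ih'
    simp only [Matrix.conjTranspose_apply] at ih'
    by_cases hx : x (Fin.last n) = y (Fin.last n)
    · simp only [hx, if_true, mul_one, ih', Matrix.one_apply]
      congr 1
      rw [eq_iff_iff]
      constructor
      · intro h'
        rw [← Fin.snoc_init_self x, ← Fin.snoc_init_self y, h', hx]
      · rintro rfl; rfl
    · have : x ≠ y := fun h' => hx (by rw [h'])
      simp [hx, this]

theorem UU_star_mul (h : Orth u) (n : ℕ) : (UU u n)ᴴ * UU u n = 1 := by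
  induction n with
  | zero =>
    ext x y
    have : x = y := Subsingleton.elim _ _
    simp [Matrix.mul_apply, Matrix.one_apply, UU, this]
  | succ n ih =>
    ext x y
    rw [Matrix.mul_apply, sum_cons, Finset.sum_comm]
    have : ∀ (t : Fin n → X), ∑ a, (UU u (n+1))ᴴ x (Fin.cons a t) * (UU u (n+1)) (Fin.cons a t) y
        = star (UU u n t (Fin.tail x)) * (if x 0 = y 0 then 1 else 0) *
          (UU u n t (Fin.tail y)) := by
      intro t
      rw [← h.col, Finset.mul_sum, Finset.sum_mul]
      refine Finset.sum_congr rfl fun a _ => ?_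
      rw [Matrix.conjTranspose_apply, UU_cons, UU_cons]
      simp [h.sa, mul_assoc]
    simp_rw [this]
    have ih' := congrFun (congrFun ih (Fin.tail x)) (Fin.tail y)
    rw [Matrix.mul_apply] at ih'
    simp only [Matrix.conjTranspose_apply] at ih'
    by_cases hx : x 0 = y 0
    · simp only [hx, if_true, mul_one, ih', Matrix.one_apply]
      congr 1
      rw [eq_iff_iff]
      constructor
      · intro h'
        rw [← Fin.cons_self_tail x, ← Fin.cons_self_tail y, h', hx]
      · rintro rfl; rfl
    · have : x ≠ y := fun h' => hx (by rw [h'])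
      simp [hx, this]

theorem RR_id : RR u idPartition := by
  have h1 : ∀ x y : Fin 1 → X, Resp idPartition x y ↔ x = y := by
    intro x y
    constructor
    · intro h
      have := @h (Sum.inl 0) (Sum.inr 0) trivial
      ext i
      rw [Subsingleton.elim i 0]
      simpa [Setoid.ker_def] using this
    · rintro rfl a b -
      rcases a with a | a <;> rcases b with b | b <;>
        simp [Setoid.ker_def, Subsingleton.elim a b]
  have : TT X A idPartition = 1 := by
    ext x y
    simp [TT, h1, Matrix.one_apply, eq_comm]
  simp [RR, this]

theorem TT_involution {k l : ℕ} (p : Partition k l) : TT X A (involution p) = (TT X A p)ᴴ := by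
  ext x y
  have : Resp (involution p) y x ↔ Resp p x y := by
    apply resp_comap p Sum.swap Sum.swap <;> simp
  rw [Matrix.conjTranspose_apply, TT_congr this]
  simp only [TT]
  split_ifs <;> simp

theorem RR_involution (h : Orth u) {k l : ℕ} (p : Partition k l) (hp : RR u p) :
    RR u (involution p) := by
  have h1 := congrArg conjTranspose hp
  rw [conjTranspose_mul, conjTranspose_mul, ← TT_involution] at h1
  have h2 : UU u k * (TT X A (involution p) * (UU u l)ᴴ) * UU u l = 
    UU u k * ((UU u k)ᴴ * TT X A (involution p)) * UU u l := by rw [h1]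
  rw [← Matrix.mul_assoc, Matrix.mul_assoc _ (UU u l)ᴴ, UU_star_mul h, Matrix.mul_one,
    ← Matrix.mul_assoc, UU_mul_star h, Matrix.one_mul] at h2
  exact h2

theorem resp_tensor {k l k' l' : ℕ} (p : Partition k l) (q : Partition k' l')
    (i : Fin k → X) (i' : Fin k' → X) (t : Fin l → X) (t' : Fin l' → X) :
    Resp (tensor p q) (Fin.append i i') (Fin.append t t') ↔ Resp p i t ∧ Resp q i' t' := by
  constructor
  · intro h
    constructor
    · intro x y hxy
      have := @h (Sum.map (Fin.castAdd k') (Fin.castAdd l') x)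
        (Sum.map (Fin.castAdd k') (Fin.castAdd l') y) (by
          change Sum.LiftRel (@Setoid.r _ p) (@Setoid.r _ q)
            ((Equiv.sumSumSumComm (Fin k) (Fin k') (Fin l) (Fin l'))
            (Sum.map finSumFinEquiv.symm finSumFinEquiv.symm _))
            ((Equiv.sumSumSumComm (Fin k) (Fin k') (Fin l) (Fin l'))
            (Sum.map finSumFinEquiv.symm finSumFinEquiv.symm _))
          have := Sum.LiftRel.inl (r := @Setoid.r _ p) (s := @Setoid.r _ q) hxy
          rcases x with x | x <;> rcases y with y | y <;> simpa using this)
      rcases x with x | x <;> rcases y with y | y <;>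
        simpa [Setoid.ker_def] using this
    · intro x y hxy
      have := @h (Sum.map (Fin.natAdd k) (Fin.natAdd l) x)
        (Sum.map (Fin.natAdd k) (Fin.natAdd l) y) (by
          change Sum.LiftRel (@Setoid.r _ p) (@Setoid.r _ q)
            ((Equiv.sumSumSumComm (Fin k) (Fin k') (Fin l) (Fin l'))
            (Sum.map finSumFinEquiv.symm finSumFinEquiv.symm _))
            ((Equiv.sumSumSumComm (Fin k) (Fin k') (Fin l) (Fin l'))
            (Sum.map finSumFinEquiv.symm finSumFinEquiv.symm _))
          have := Sum.LiftRel.inr (r := @Setoid.r _ p) (s := @Setoid.r _ q) hxy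
          rcases x with x | x <;> rcases y with y | y <;> simpa using this)
      rcases x with x | x <;> rcases y with y | y <;>
        simpa [Setoid.ker_def] using this
  · rintro ⟨h1, h2⟩ x y hxy
    have key : ∀ z, Sum.elim (Fin.append i i') (Fin.append t t') z =
        Sum.elim (Sum.elim i t) (Sum.elim i' t')
        ((Equiv.sumSumSumComm (Fin k) (Fin k') (Fin l) (Fin l'))
      (Sum.map finSumFinEquiv.symm finSumFinEquiv.symm z)) := by
      intro z
      rcases z with z | z <;> refine Fin.addCases (fun z => ?_) (fun z => ?_) z <;> simp
    rw [Setoid.ker_def, key, key]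
    have hxy' : Sum.LiftRel (@Setoid.r _ p) (@Setoid.r _ q)
      ((Equiv.sumSumSumComm (Fin k) (Fin k') (Fin l) (Fin l'))
      (Sum.map finSumFinEquiv.symm finSumFinEquiv.symm x))
      ((Equiv.sumSumSumComm (Fin k) (Fin k') (Fin l) (Fin l'))
      (Sum.map finSumFinEquiv.symm finSumFinEquiv.symm y)) := hxy
    revert hxy'
    generalize ((Equiv.sumSumSumComm (Fin k) (Fin k') (Fin l) (Fin l'))
      (Sum.map finSumFinEquiv.symm finSumFinEquiv.symm x)) = a
    generalize ((Equiv.sumSumSumComm (Fin k) (Fin k') (Fin l) (Fin l'))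
      (Sum.map finSumFinEquiv.symm finSumFinEquiv.symm y)) = b
    intro hab
    cases hab with
    | inl h => exact h1 h
    | inr h => exact h2 h

theorem TT_tensor {k l k' l' : ℕ} (p : Partition k l) (q : Partition k' l')
    (i : Fin k → X) (i' : Fin k' → X) (t : Fin l → X) (t' : Fin l' → X) :
    TT X A (tensor p q) (Fin.append t t') (Fin.append i i') = TT X A p t i * TT X A q t' i' := by
  by_cases h : Resp p i t ∧ Resp q i' t'
  · rw [TT_pos ((resp_tensor p q i i' t t').2 h), TT_pos h.1, TT_pos h.2, one_mul]
  · rw [TT_neg (fun h' => h ((resp_tensor p q i i' t t').1 h'))]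
    by_cases h1 : Resp p i t
    · rw [TT_neg (fun h2 : Resp q i' t' => h ⟨h1, h2⟩), mul_zero]
    · rw [TT_neg h1, zero_mul]

theorem TT_comm {k l : ℕ} (p : Partition k l) (t i) (a : A) :
    TT X A p t i * a = a * TT X A p t i := by
  simp only [TT]; split_ifs <;> simp

theorem RR_tensor {k l k' l' : ℕ} (p : Partition k l) (q : Partition k' l')
    (hp : RR u p) (hq : RR u q) : RR u (tensor p q) := by
  ext j i
  obtain ⟨⟨i, i'⟩, rfl⟩ := (Fin.appendEquiv k k').surjective i
  obtain ⟨⟨j, j'⟩, rfl⟩ := (Fin.appendEquiv l l').surjective j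
  change _ = (TT X A (tensor p q) * UU u (k + k')) (Fin.append j j') (Fin.append i i')
  change (UU u (l + l') * TT X A (tensor p q)) (Fin.append j j') (Fin.append i i') = _
  rw [Matrix.mul_apply, Matrix.mul_apply, sum_append, sum_append]
  simp only [TT_tensor, UU_append, Fin.append_left, Fin.append_right]
  have h1 := congrFun (congrFun hp j) i
  have h2 := congrFun (congrFun hq j') i'
  rw [Matrix.mul_apply, Matrix.mul_apply] at h1 h2
  calc _ = (∑ x, UU u l j x * TT X A p x i) * (∑ y, UU u l' j' y * TT X A q y i') := by
        rw [Finset.sum_mul_sum]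
        refine Finset.sum_congr rfl fun x _ => Finset.sum_congr rfl fun y _ => ?_
        rw [mul_assoc, mul_assoc, ← mul_assoc _ (TT X A p x i), ← TT_comm p, mul_assoc]
    _ = _ := by
        rw [h1, h2, Finset.sum_mul_sum]
        refine Finset.sum_congr rfl fun x _ => Finset.sum_congr rfl fun y _ => ?_
        rw [mul_assoc, mul_assoc, ← mul_assoc _ (TT X A q j' y), ← TT_comm q, mul_assoc]

end Model
end EasyQG
namespace EasyQG

open Matrix

set_option linter.all false

section Model2

variable {X A : Type} [Fintype X] [DecidableEq X] [Ring A] [StarRing A] {u : X → X → A}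

theorem resp_rotUL {k l : ℕ} (p : Partition (k + 1) l) (i : Fin k → X) (j : Fin (l + 1) → X) :
    Resp (rotUL p) i j ↔ Resp p (Fin.cons (j 0) i : Fin (k + 1) → X) (Fin.tail j) := by
  refine resp_comap p _ (Sum.elim (fun i => Fin.cases (Sum.inr 0) (fun i' => Sum.inl i') i)
    (fun j => Sum.inr j.succ)) ?_ ?_ _ _ _ _ ?_
  · rintro (x | x)
    · refine Fin.cases ?_ (fun x => ?_) x <;> simp
    · simp
  · rintro (x | x)
    · simp
    · refine Fin.cases ?_ (fun x => ?_) x <;> simp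
  · rintro (x | x)
    · simp
    · refine Fin.cases ?_ (fun x => ?_) x <;> simp [Fin.tail]

theorem resp_rotUR {k l : ℕ} (p : Partition (k + 1) l) (i : Fin k → X) (j : Fin (l + 1) → X) :
    Resp (rotUR p) i j ↔
      Resp p (Fin.snoc i (j (Fin.last l)) : Fin (k + 1) → X) (Fin.init j) := by
  refine resp_comap p _ (Sum.elim
    (fun i => Fin.lastCases (Sum.inr (Fin.last l)) (fun i' => Sum.inl i') i)
    (fun j => Sum.inr j.castSucc)) ?_ ?_ _ _ _ _ ?_
  · rintro (x | x)
    · refine Fin.lastCases ?_ (fun x => ?_) x <;> simp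
    · simp
  · rintro (x | x)
    · simp
    · refine Fin.lastCases ?_ (fun x => ?_) x <;> simp
  · rintro (x | x)
    · simp
    · refine Fin.lastCases ?_ (fun x => ?_) x <;> simp [Fin.init]

theorem RR_rotUL (h : Orth u) {k l : ℕ} (p : Partition (k + 1) l) (hp : RR u p) :
    RR u (rotUL p) := by
  ext j i
  rw [Matrix.mul_apply, Matrix.mul_apply, sum_cons]
  have e1 : ∀ (s : Fin k → X) (j : Fin (l + 1) → X), TT X A (rotUL p) j s =
    TT X A p (Fin.tail j) (Fin.cons (j 0) s : Fin (k + 1) → X) :=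
    fun s j => TT_congr (resp_rotUL p s j)
  have e2 : ∀ a : X, ∑ t : Fin l → X, UU u (l + 1) j (Fin.cons a t) *
      TT X A (rotUL p) (Fin.cons a t) i = ∑ b, ∑ s : Fin k → X,
        (u (j 0) a * u b a) * (TT X A p (Fin.tail j) (Fin.cons b s : Fin (k + 1) → X) *
          UU u k s i) := by
    intro a
    have h1 := congrFun (congrFun hp (Fin.tail j)) (Fin.cons a i)
    rw [Matrix.mul_apply, Matrix.mul_apply, sum_cons] at h1
    calc _ = u (j 0) a * ∑ t : Fin l → X, UU u l (Fin.tail j) t *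
            TT X A p t (Fin.cons a i : Fin (k + 1) → X) := by
          rw [Finset.mul_sum]
          refine Finset.sum_congr rfl fun t _ => ?_
          rw [e1, UU_cons, mul_assoc]
          simp
      _ = _ := by
          rw [h1, Finset.mul_sum]
          refine Finset.sum_congr rfl fun b _ => ?_
          rw [Finset.mul_sum]
          refine Finset.sum_congr rfl fun s _ => ?_
          rw [UU_cons, TT_comm]
          simp only [Fin.cons_zero, Fin.tail_cons]
          rw [TT_comm]
          simp only [mul_assoc]
  simp_rw [e2, e1]
  rw [Finset.sum_comm]
  simp_rw [Finset.sum_comm (s := (Finset.univ : Finset X)) (t := (Finset.univ : Finset (Fin k → X)))]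
  refine Finset.sum_congr rfl fun s _ => ?_
  simp_rw [← Finset.sum_mul, h.row]
  simp

theorem RR_rotUR (h : Orth u) {k l : ℕ} (p : Partition (k + 1) l) (hp : RR u p) :
    RR u (rotUR p) := by
  -- via the involution we may equivalently use the column relations; direct computation
  ext j i
  rw [Matrix.mul_apply, Matrix.mul_apply, sum_snoc, Finset.sum_comm]
  have e1 : ∀ (s : Fin k → X) (j : Fin (l + 1) → X), TT X A (rotUR p) j s =
    TT X A p (Fin.init j) (Fin.snoc s (j (Fin.last l)) : Fin (k + 1) → X) :=
    fun s j => TT_congr (resp_rotUR p s j)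
  have e2 : ∀ a : X, ∑ t : Fin l → X, UU u (l + 1) j (Fin.snoc t a) *
      TT X A (rotUR p) (Fin.snoc t a) i = ∑ s : Fin k → X, ∑ b,
        (TT X A p (Fin.init j) (Fin.snoc s b : Fin (k + 1) → X) *
          UU u k s i) * (u b a * u (j (Fin.last l)) a) := by
    intro a
    have h1 := congrFun (congrFun hp (Fin.init j)) (Fin.snoc i a)
    rw [Matrix.mul_apply, Matrix.mul_apply, sum_snoc] at h1
    calc _ = (∑ t : Fin l → X, UU u l (Fin.init j) t *
            TT X A p t (Fin.snoc i a : Fin (k + 1) → X)) * u (j (Fin.last l)) a := by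
          rw [Finset.sum_mul]
          refine Finset.sum_congr rfl fun t _ => ?_
          rw [e1, UU_snoc, mul_assoc, mul_assoc, TT_comm]
          simp
      _ = _ := by
          rw [h1, Finset.sum_mul]
          refine Finset.sum_congr rfl fun b _ => ?_
          rw [Finset.sum_mul]
          refine Finset.sum_congr rfl fun s _ => ?_
          rw [UU_snoc]
          simp [mul_assoc]
  simp_rw [e2, e1]
  rw [Finset.sum_comm]
  refine Finset.sum_congr rfl fun s _ => ?_
  rw [Finset.sum_comm]
  simp_rw [← Finset.mul_sum, h.row]
  simp

theorem rotLU_eq {k l : ℕ} (p : Partition k (l + 1)) :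
    rotLU p = involution (rotUL (involution p)) := by
  ext x y
  have : ∀ x : Fin (k + 1) ⊕ Fin l,
    (Sum.elim (fun i => Fin.cases (Sum.inr (0 : Fin (l + 1))) (fun i' => Sum.inl i') i)
      (fun j => Sum.inr j.succ)) x = Sum.swap ((Sum.elim (fun i => Sum.inl i.succ)
      (fun j => Fin.cases (Sum.inl (0 : Fin (l + 1))) (fun j' => Sum.inr j') j))
        (Sum.swap x) : Fin (l + 1) ⊕ Fin k) := by
    rintro (x | x)
    · refine Fin.cases ?_ (fun x => ?_) x <;> simp
    · simp
  change p.r _ _ ↔ p.r _ _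
  rw [← this, ← this]

theorem rotRU_eq {k l : ℕ} (p : Partition k (l + 1)) :
    rotRU p = involution (rotUR (involution p)) := by
  ext x y
  have : ∀ x : Fin (k + 1) ⊕ Fin l,
    (Sum.elim (fun i => Fin.lastCases (Sum.inr (Fin.last l)) (fun i' => Sum.inl i') i)
      (fun j => Sum.inr j.castSucc)) x = Sum.swap ((Sum.elim (fun i => Sum.inl i.castSucc)
      (fun j => Fin.lastCases (Sum.inl (Fin.last l)) (fun j' => Sum.inr j') j))
        (Sum.swap x) : Fin (l + 1) ⊕ Fin k) := by
    rintro (x | x)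
    · refine Fin.lastCases ?_ (fun x => ?_) x <;> simp
    · simp
  change p.r _ _ ↔ p.r _ _
  rw [← this, ← this]

/-- The relation generating the blocks of the vertical concatenation. -/
def compRel {k l m : ℕ} (p : Partition k l) (q : Partition l m) :
    Setoid (Fin k ⊕ (Fin l ⊕ Fin m)) :=
  (Relation.EqvGen.setoid (fun x y : Fin k ⊕ (Fin l ⊕ Fin m) =>
      (∃ a b, inSameBlock p a b ∧ Sum.map id Sum.inl a = x ∧ Sum.map id Sum.inl b = y) ∨
      (∃ a b, inSameBlock q a b ∧ Sum.inr a = x ∧ Sum.inr b = y)))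

theorem resp_both {k l m : ℕ} (p : Partition k l) (q : Partition l m) (x : Fin k → X)
    (y : Fin l → X) (z : Fin m → X) :
    (Resp p x y ∧ Resp q y z) ↔ compRel p q ≤ Setoid.ker (Sum.elim x (Sum.elim y z)) := by
  constructor
  · rintro ⟨h1, h2⟩
    apply Setoid.eqvGen_le
    rintro _ _ (⟨a, b, hab, rfl, rfl⟩ | ⟨a, b, hab, rfl, rfl⟩)
    · have := h1 hab
      rcases a with a | a <;> rcases b with b | b <;> simpa [Setoid.ker_def] using this
    · have := h2 hab
      simpa [Setoid.ker_def] using this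
  · intro h
    constructor
    · intro a b hab
      have := h (Relation.EqvGen.rel _ _ (Or.inl ⟨a, b, hab, rfl, rfl⟩))
      rcases a with a | a <;> rcases b with b | b <;> simpa [Setoid.ker_def] using this
    · intro a b hab
      have := h (Relation.EqvGen.rel _ _ (Or.inr ⟨a, b, hab, rfl, rfl⟩))
      simpa [Setoid.ker_def] using this

open Classical in
theorem count_comp [AddCommGroup X] {k l m : ℕ} (p : Partition k l) (q : Partition l m)
    (x : Fin k → X) (z : Fin m → X) (h : Resp (comp p q) x z) :
    (Finset.univ.filter fun y : Fin l → X => Resp p x y ∧ Resp q y z).card =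
      (Finset.univ.filter fun y : Fin l → X => Resp p 0 y ∧ Resp q y 0).card := by
  obtain ⟨y0, hy0⟩ : ∃ y0 : Fin l → X, Resp p x y0 ∧ Resp q y0 z := by
    let y0 : Fin l → X := fun b => if hb : ∃ a : Fin k ⊕ Fin m,
      (compRel p q) (Sum.map id Sum.inr a) (Sum.inr (Sum.inl b)) then
        Sum.elim x z hb.choose else 0
    have hout : ∀ a a' : Fin k ⊕ Fin m, (compRel p q) (Sum.map id Sum.inr a) (Sum.map id Sum.inr a')
        → Sum.elim x z a = Sum.elim x z a' := fun a a' haa => h haa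
    have hy : ∀ a b, (compRel p q) (Sum.map id Sum.inr a) (Sum.inr (Sum.inl b)) →
        y0 b = Sum.elim x z a := by
      intro a b hab
      have hb : ∃ a : Fin k ⊕ Fin m,
        (compRel p q) (Sum.map id Sum.inr a) (Sum.inr (Sum.inl b)) := ⟨a, hab⟩
      simp only [y0, dif_pos hb]
      exact hout _ _ ((compRel p q).trans' hb.choose_spec ((compRel p q).symm' hab))
    have hyy : ∀ b b', (compRel p q) (Sum.inr (Sum.inl b)) (Sum.inr (Sum.inl b')) →
        y0 b = y0 b' := by
      intro b b' hbb
      by_cases hb : ∃ a : Fin k ⊕ Fin m,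
        (compRel p q) (Sum.map id Sum.inr a) (Sum.inr (Sum.inl b))
      · obtain ⟨a, ha⟩ := hb
        rw [hy a b ha, hy a b' ((compRel p q).trans' ha hbb)]
      · have hb' : ¬ ∃ a : Fin k ⊕ Fin m,
          (compRel p q) (Sum.map id Sum.inr a) (Sum.inr (Sum.inl b')) := by
          rintro ⟨a, ha⟩
          exact hb ⟨a, (compRel p q).trans' ha ((compRel p q).symm' hbb)⟩
        simp only [y0, dif_neg hb, dif_neg hb']
    refine ⟨y0, (resp_both p q x y0 z).2 ?_⟩
    rintro (a | a | a) (b | b | b) hab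
    · exact hout (Sum.inl a) (Sum.inl b) hab
    · exact (hy (Sum.inl a) b hab).symm
    · exact hout (Sum.inl a) (Sum.inr b) hab
    · exact hy (Sum.inl b) a ((compRel p q).symm' hab)
    · exact hyy a b hab
    · exact hy (Sum.inr b) a ((compRel p q).symm' hab)
    · exact hout (Sum.inr a) (Sum.inl b) hab
    · exact (hy (Sum.inr a) b hab).symm
    · exact hout (Sum.inr a) (Sum.inr b) hab
  have key : ∀ y : Fin l → X, (Resp p x (y + y0) ∧ Resp q (y + y0) z) ↔
      (Resp p 0 y ∧ Resp q y 0) := by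
    intro y
    have h1 : Sum.elim x (Sum.elim (y + y0) z) = Sum.elim (0 : Fin k → X)
        (Sum.elim y (0 : Fin m → X)) + Sum.elim x (Sum.elim y0 z) := by
      funext a
      rcases a with a | a | a <;> simp
    rw [resp_both] at hy0 ⊢
    rw [resp_both, h1]
    constructor
    · intro h' a b hab
      have e1 := h' hab
      have e2 := hy0 hab
      simp only [Setoid.ker_def, Pi.add_apply] at e1 e2 ⊢
      rw [e2] at e1
      exact add_right_cancel e1
    · intro h' a b hab
      have e1 := h' hab
      have e2 := hy0 hab
      simp only [Setoid.ker_def, Pi.add_apply] at e1 e2 ⊢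
      rw [e2, e1]
  symm
  apply Finset.card_bij (fun y _ => y + y0)
  · intro y hy
    simpa [key] using hy
  · intro a _ b _ hab
    exact add_right_cancel hab
  · intro y hy
    refine ⟨y - y0, ?_, by simp⟩
    rw [Finset.mem_filter] at hy ⊢
    rw [← key]
    simpa using hy

theorem TT_comp_aux [AddCommGroup X] {k l m : ℕ} (p : Partition k l) (q : Partition l m) :
    ∃ c : ℕ, c ≠ 0 ∧ TT X A q * TT X A p = c • TT X A (comp p q) := by
  classical
  refine ⟨(Finset.univ.filter fun y : Fin l → X => Resp p 0 y ∧ Resp q y 0).card, ?_, ?_⟩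
  · rw [← Nat.pos_iff_ne_zero, Finset.card_pos]
    refine ⟨0, ?_⟩
    rw [Finset.mem_filter]
    refine ⟨Finset.mem_univ _, ?_, ?_⟩
    · rintro (a | a) (b | b) _ <;> rfl
    · rintro (a | a) (b | b) _ <;> rfl
  · ext z x
    have e : (TT X A q * TT X A p) z x =
      ((Finset.univ.filter fun y : Fin l → X => Resp p x y ∧ Resp q y z).card : A) := by
      rw [Matrix.mul_apply, Finset.card_filter, Nat.cast_sum]
      refine Finset.sum_congr rfl fun y _ => ?_
      by_cases h1 : Resp p x y <;> by_cases h2 : Resp q y z <;> simp [TT, h1, h2]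
    rw [e, Matrix.smul_apply]
    by_cases h : Resp (comp p q) x z
    · rw [count_comp p q x z h, TT_pos h]
      simp
    · rw [TT_neg h, smul_zero]
      have : (Finset.univ.filter fun y : Fin l → X => Resp p x y ∧ Resp q y z) = ∅ := by
        rw [Finset.filter_eq_empty_iff]
        intro y _ hy
        apply h
        rw [resp_both] at hy
        intro a b hab
        have := hy (x := Sum.map id Sum.inr a) (y := Sum.map id Sum.inr b) hab
        rcases a with a | a <;> rcases b with b | b <;> simpa [Setoid.ker_def] using this
      rw [this]
      simp

theorem TT_comp [Nonempty X] {k l m : ℕ} (p : Partition k l) (q : Partition l m) :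
    ∃ c : ℕ, c ≠ 0 ∧ TT X A q * TT X A p = c • TT X A (comp p q) := by
  haveI : NeZero (Fintype.card X) := ⟨Fintype.card_ne_zero⟩
  letI := (Fintype.equivFin X).addCommGroup
  exact TT_comp_aux p q

theorem RR_comp [Nonempty X] (hA : ∀ n : ℕ, n ≠ 0 → ∀ a : A, n • a = 0 → a = 0)
    {k l m : ℕ} (p : Partition k l) (q : Partition l m) (hp : RR u p) (hq : RR u q) :
    RR u (comp p q) := by
  obtain ⟨c, hc, e⟩ := TT_comp (X := X) (A := A) p q
  have h1 : UU u m * (TT X A q * TT X A p) = TT X A q * TT X A p * UU u k := by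
    rw [← Matrix.mul_assoc, hq, Matrix.mul_assoc, hp, Matrix.mul_assoc]
  rw [e, Matrix.mul_smul, Matrix.smul_mul, ← sub_eq_zero, ← smul_sub] at h1
  rw [RR, ← sub_eq_zero]
  ext x y
  exact hA c hc _ (congrFun (congrFun h1 x) y)

/-- The category of partitions of a matrix model. -/
def modelCat [Nonempty X] (hA : ∀ n : ℕ, n ≠ 0 → ∀ a : A, n • a = 0 → a = 0) (h : Orth u) :
    PartitionCategory where
  mem := {x | RR u x.2.2}
  id_mem := RR_id
  tensor_mem := fun hp hq => RR_tensor _ _ hp hq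
  comp_mem := fun hp hq => RR_comp hA _ _ hp hq
  involution_mem := fun hp => RR_involution h _ hp
  rotUL_mem := fun hp => RR_rotUL h _ hp
  rotUR_mem := fun hp => RR_rotUR h _ hp
  rotLU_mem := fun {k l p} hp => by
    rw [rotLU_eq]
    exact RR_involution h _ (RR_rotUL h _ (RR_involution h _ hp))
  rotRU_mem := fun {k l p} hp => by
    rw [rotRU_eq]
    exact RR_involution h _ (RR_rotUR h _ (RR_involution h _ hp))

end Model2
end EasyQG
namespace EasyQG

open Matrix

set_option linter.all false

section Model3

variable {X A : Type} [Fintype X] [DecidableEq X] [Ring A] [StarRing A] {u : X → X → A}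

/-- A labelling of `4k` points assembled from four labellings of `k` points. -/
def wd4 {k : ℕ} (a b c d : Fin k → X) (n : Fin (4 * k)) : X :=
  if h : n.1 < k then a ⟨n.1, h⟩
  else if h2 : n.1 < 2 * k then b ⟨2 * k - 1 - n.1, by omega⟩
  else if h3 : n.1 < 3 * k then c ⟨n.1 - 2 * k, by omega⟩
  else d ⟨4 * k - 1 - n.1, by omega⟩

/-- The letter at a position of `π_k`. -/
def ltr (k n : ℕ) : ℕ := if n % (2 * k) < k then n % (2 * k) else 2 * k - 1 - n % (2 * k)

theorem ltr_eq {k n : ℕ} (h : n < 4 * k) : ltr k n =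
    if n < k then n else if n < 2 * k then 2 * k - 1 - n else if n < 3 * k then n - 2 * k
    else 4 * k - 1 - n := by
  have : n % (2 * k) = if n < 2 * k then n else n - 2 * k := by
    split_ifs with h1
    · exact Nat.mod_eq_of_lt h1
    · rw [Nat.mod_eq_sub_mod (by omega), Nat.mod_eq_of_lt (by omega)]
  unfold ltr
  rw [this]
  split_ifs <;> omega

theorem ltr_lt {k n : ℕ} (h : n < 4 * k) : ltr k n < k := by
  rw [ltr_eq h]
  split_ifs <;> omega

theorem wd4_same {k : ℕ} (a : Fin k → X) (n : Fin (4 * k)) :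
    wd4 a a a a n = a ⟨ltr k n, ltr_lt n.2⟩ := by
  unfold wd4
  split_ifs <;> congr 2 <;> rw [ltr_eq n.2] <;> split_ifs <;> rfl

theorem wd4_surj {k : ℕ} (j : Fin (4 * k) → X) : ∃ a b c d, j = wd4 a b c d := by
  refine ⟨fun m => j ⟨m, by omega⟩, fun m => j ⟨2 * k - 1 - m, by omega⟩,
    fun m => j ⟨2 * k + m, by omega⟩, fun m => j ⟨4 * k - 1 - m, by omega⟩, ?_⟩
  funext n
  unfold wd4
  split_ifs <;> congr 1 <;> ext <;> simp <;> omega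

theorem resp_pi {k : ℕ} (i : Fin 0 → X) (a b c d : Fin k → X) :
    Resp (piPartition k) i (wd4 a b c d) ↔ (a = b ∧ c = d ∧ b = c) := by
  constructor
  · intro h
    have h' : ∀ n m : Fin (4 * k), ltr k n = ltr k m → wd4 a b c d n = wd4 a b c d m :=
      fun n m hnm => @h (Sum.inr n) (Sum.inr m) hnm
    have e0 : ∀ m : Fin k, wd4 a b c d ⟨m, by omega⟩ = a m := by
      intro m; simp [wd4]
    have e1 : ∀ m : Fin k, wd4 a b c d ⟨2 * k - 1 - m, by omega⟩ = b m := by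
      intro m
      unfold wd4
      rw [dif_neg (by simp; omega), dif_pos (by simp; omega)]
      congr 1; ext; simp; omega
    have e2 : ∀ m : Fin k, wd4 a b c d ⟨2 * k + m, by omega⟩ = c m := by
      intro m
      unfold wd4
      rw [dif_neg (by simp; omega), dif_neg (by simp), dif_pos (by simp; omega)]
      congr 1; ext; simp
    have e3 : ∀ m : Fin k, wd4 a b c d ⟨4 * k - 1 - m, by omega⟩ = d m := by
      intro m
      unfold wd4
      rw [dif_neg (by simp; omega), dif_neg (by simp; omega), dif_neg (by simp; omega)]
      congr 1; ext; simp; omega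
    refine ⟨funext fun m => ?_, funext fun m => ?_, funext fun m => ?_⟩
    · rw [← e0, ← e1]
      apply h'
      rw [ltr_eq (by simp; omega), ltr_eq (by simp; omega)]
      simp; split_ifs <;> omega
    · rw [← e2, ← e3]
      apply h'
      rw [ltr_eq (by simp; omega), ltr_eq (by simp; omega)]
      simp; split_ifs <;> omega
    · rw [← e1, ← e2]
      apply h'
      rw [ltr_eq (by simp; omega), ltr_eq (by simp; omega)]
      simp; split_ifs <;> omega
  · rintro ⟨rfl, rfl, rfl⟩
    rintro (n | n) (m | m) hnm
    · exact n.elim0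
    · exact n.elim0
    · exact m.elim0
    · have : ltr k n = ltr k m := hnm
      change wd4 a a a a n = wd4 a a a a m
      rw [wd4_same, wd4_same]
      congr 2

theorem UU_cast {m n : ℕ} (h : m = n) (x y : Fin n → X) :
    UU u n x y = UU u m (x ∘ Fin.cast h) (y ∘ Fin.cast h) := by
  subst h; rfl

theorem star_UU (h : Orth u) {n : ℕ} (x y : Fin n → X) :
    star (UU u n x y) = UU u n (x ∘ Fin.rev) (y ∘ Fin.rev) := by
  induction n with
  | zero => simp [UU]
  | succ n ih =>
    rw [UU_cons, UU_snoc, star_mul, ih, h.sa]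
    congr 1
    · congr 1 <;> funext m <;> simp [Fin.tail, Fin.init, Fin.rev_castSucc]
    · simp

theorem UU_wd4 (h : Orth u) {k : ℕ} (a b c d a' b' c' d' : Fin k → X) :
    UU u (4 * k) (wd4 a b c d) (wd4 a' b' c' d') =
      UU u k a a' * star (UU u k b b') * UU u k c c' * star (UU u k d d') := by
  rw [UU_cast (show k + k + k + k = 4 * k by ring), UU_append, UU_append, UU_append,
    star_UU h, star_UU h]
  have e0 : ∀ a b c d : Fin k → X, (fun i : Fin k => (wd4 a b c d ∘
      Fin.cast (show k + k + k + k = 4 * k by ring))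
      (Fin.castAdd k (Fin.castAdd k (Fin.castAdd k i)))) = a := by
    intro a b c d; funext i; simp [wd4]
  have e1 : ∀ a b c d : Fin k → X, (fun i : Fin k => (wd4 a b c d ∘
      Fin.cast (show k + k + k + k = 4 * k by ring))
      (Fin.castAdd k (Fin.castAdd k (Fin.natAdd k i)))) = b ∘ Fin.rev := by
    intro a b c d; funext i
    simp only [wd4, Function.comp]
    rw [dif_neg (by simp), dif_pos (by simp; omega)]
    congr 1; ext; simp; omega
  have e2 : ∀ a b c d : Fin k → X, (fun i : Fin k => (wd4 a b c d ∘
      Fin.cast (show k + k + k + k = 4 * k by ring))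
      (Fin.castAdd k (Fin.natAdd (k + k) i))) = c := by
    intro a b c d; funext i
    simp only [wd4, Function.comp]
    rw [dif_neg (by simp; omega), dif_neg (by simp; omega), dif_pos (by simp; omega)]
    congr 1; ext; simp; omega
  have e3 : ∀ a b c d : Fin k → X, (fun i : Fin k => (wd4 a b c d ∘
      Fin.cast (show k + k + k + k = 4 * k by ring))
      (Fin.natAdd (k + k + k) i)) = d ∘ Fin.rev := by
    intro a b c d; funext i
    simp only [wd4, Function.comp]
    rw [dif_neg (by simp; omega), dif_neg (by simp; omega), dif_neg (by simp; omega)]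
    congr 1; ext; simp; omega
  rw [e0, e0, e1, e1, e2, e2, e3, e3]

theorem RR_pi_iff (h : Orth u) {k : ℕ} : RR u (piPartition k) ↔
    ∀ a b c d : Fin k → X, ∑ t : Fin k → X,
      UU u k a t * star (UU u k b t) * UU u k c t * star (UU u k d t) =
        if (a = b ∧ c = d ∧ b = c) then 1 else 0 := by
  have e : ∀ (a b c d : Fin k → X) (i : Fin 0 → X),
      (UU u (4 * k) * TT X A (piPartition k)) (wd4 a b c d) i = ∑ t : Fin k → X,
      UU u k a t * star (UU u k b t) * UU u k c t * star (UU u k d t) := by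
    intro a b c d i
    rw [Matrix.mul_apply]
    symm
    refine Finset.sum_of_injOn (fun t => wd4 t t t t) ?_ ?_ ?_ ?_
    · intro t _ s _ hts
      funext m
      have := congrFun hts ⟨m, by omega⟩
      simpa [wd4] using this
    · intro t _; simp
    · intro t _ ht
      rw [TT_neg, mul_zero]
      intro hr
      obtain ⟨a', b', c', d', rfl⟩ := wd4_surj t
      rw [resp_pi] at hr
      obtain ⟨rfl, rfl, rfl⟩ := hr
      exact ht ⟨a', by simp, rfl⟩
    · intro t _
      rw [UU_wd4 h, TT_pos ((resp_pi _ _ _ _ _).2 ⟨rfl, rfl, rfl⟩), mul_one]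
  have e' : ∀ (a b c d : Fin k → X) (i : Fin 0 → X),
      (TT X A (piPartition k) * UU u 0) (wd4 a b c d) i =
        if (a = b ∧ c = d ∧ b = c) then 1 else 0 := by
    intro a b c d i
    rw [Matrix.mul_apply, Fintype.sum_eq_single i (fun j hj => absurd (Subsingleton.elim _ _) hj)]
    have : UU u 0 i i = 1 := by simp [UU]
    rw [this, mul_one]
    split_ifs with h1
    · exact TT_pos ((resp_pi _ _ _ _ _).2 h1)
    · exact TT_neg (fun h2 => h1 ((resp_pi _ _ _ _ _).1 h2))
  constructor
  · intro hR a b c d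
    rw [← e a b c d Fin.elim0, hR, e']
  · intro H
    ext j i
    obtain ⟨a, b, c, d, rfl⟩ := wd4_surj j
    rw [e, e', H]

/-- Matrix models whose words of length less than `K` are partial isometries with commuting
range projections. -/
structure Lvl (K : ℕ) (u : X → X → A) : Prop extends Orth u where
  colz : ∀ i k j, i ≠ k → u i j * u k j = 0
  cube : ∀ i j, u i j * (u i j * u i j) = u i j
  comm : ∀ n, n < K → ∀ (x a : Fin n → X) (i b : X),
    (UU u n x a * star (UU u n x a)) * (u i b * u i b) =
      (u i b * u i b) * (UU u n x a * star (UU u n x a))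

theorem Lvl.zero {K : ℕ} (h : Lvl K u) {n : ℕ} (hn : n ≤ K) (x y a : Fin n → X) (hxy : x ≠ y) :
    UU u n x a * star (UU u n y a) = 0 := by
  induction n with
  | zero => exact absurd (Subsingleton.elim _ _) hxy
  | succ n ih =>
    rw [UU_cons, UU_cons, star_mul, h.sa]
    by_cases ht : Fin.tail x = Fin.tail y
    · have h0 : x 0 ≠ y 0 := by
        intro h0
        apply hxy
        rw [← Fin.cons_self_tail x, ← Fin.cons_self_tail y, ht, h0]
      have hc := h.comm n (by omega) (Fin.tail y) (Fin.tail a) (x 0) (a 0)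
      rw [ht, ← h.cube (x 0) (a 0)]
      generalize UU u n (Fin.tail y) (Fin.tail a) = w at *
      calc _ = u (x 0) (a 0) * ((u (x 0) (a 0) * u (x 0) (a 0)) * (w * star w)) * u (y 0) (a 0) := by
              simp only [mul_assoc]
        _ = u (x 0) (a 0) * (w * star w) * u (x 0) (a 0) * (u (x 0) (a 0) * u (y 0) (a 0)) := by
              rw [← hc]; simp only [mul_assoc]
        _ = 0 := by rw [h.colz _ _ _ h0, mul_zero]
    · have := ih (by omega) (Fin.tail x) (Fin.tail y) (Fin.tail a) ht
      rw [mul_assoc, ← mul_assoc (UU u n _ _), this, zero_mul, mul_zero]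

theorem Lvl.zero' {K : ℕ} (h : Lvl K u) {n : ℕ} (hn : n ≤ K) (x y a : Fin n → X) (hxy : x ≠ y) :
    star (UU u n x a) * UU u n y a = 0 := by
  have := h.zero hn (x ∘ Fin.rev) (y ∘ Fin.rev) (a ∘ Fin.rev) (by
    intro h'
    apply hxy
    funext m
    simpa using congrFun h' m.rev)
  rw [← star_UU h.toOrth, ← star_UU h.toOrth, star_star] at this
  exact this

theorem Lvl.iso {K : ℕ} (h : Lvl K u) {n : ℕ} (hn : n ≤ K) (x a : Fin n → X) :
    UU u n x a * star (UU u n x a) * UU u n x a = UU u n x a := by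
  induction n with
  | zero => simp [UU]
  | succ n ih =>
    rw [UU_cons, star_mul, h.sa]
    have hc := h.comm n (by omega) (Fin.tail x) (Fin.tail a) (x 0) (a 0)
    have hi := ih (by omega) (Fin.tail x) (Fin.tail a)
    generalize UU u n (Fin.tail x) (Fin.tail a) = w at *
    calc _ = u (x 0) (a 0) * ((w * star w) * (u (x 0) (a 0) * u (x 0) (a 0))) * w := by
            simp only [mul_assoc]
      _ = u (x 0) (a 0) * (u (x 0) (a 0) * u (x 0) (a 0)) * (w * star w * w) := by
            rw [hc]; simp only [mul_assoc]
      _ = _ := by rw [h.cube, hi]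

theorem Lvl.RR_pi {K : ℕ} (h : Lvl K u) {k : ℕ} (hk : k ≤ K) : RR u (piPartition k) := by
  rw [RR_pi_iff h.toOrth]
  intro a b c d
  by_cases h1 : a = b
  · by_cases h2 : c = d
    · by_cases h3 : b = c
      · subst h1 h2 h3
        have := congrFun (congrFun (UU_mul_star h.toOrth k) a) a
        rw [Matrix.mul_apply, Matrix.one_apply_eq] at this
        simp only [h.iso hk]
        simpa using this
      · rw [if_neg (by tauto)]
        refine Finset.sum_eq_zero fun t _ => ?_
        rw [mul_assoc (UU u k a t), h.zero' hk _ _ _ h3]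
        simp
    · rw [if_neg (by tauto)]
      refine Finset.sum_eq_zero fun t _ => ?_
      rw [mul_assoc, h.zero hk _ _ _ h2]
      simp
  · rw [if_neg (by tauto)]
    refine Finset.sum_eq_zero fun t _ => ?_
    rw [h.zero hk _ _ _ h1]
    simp

end Model3

/-- In a matrix algebra, the relation of `π_k` forces words to be orthogonal. -/
theorem pi_zero {X Ω : Type} [Fintype X] [DecidableEq X] [Fintype Ω] [DecidableEq Ω]
    {u : X → X → Matrix Ω Ω ℝ} (h : Orth u) {k : ℕ} (hR : RR u (piPartition k))
    (x y a : Fin k → X) (hxy : x ≠ y) : UU u k x a * star (UU u k y a) = 0 := by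
  rw [RR_pi_iff h] at hR
  have := hR x y y x
  rw [if_neg (by tauto)] at this
  have h2 : ∑ t : Fin k → X, Matrix.trace ((UU u k x t * star (UU u k y t)) *
      (UU u k x t * star (UU u k y t))ᴴ) = 0 := by
    rw [← Matrix.trace_sum]
    rw [← Matrix.trace_zero Ω ℝ, ← this]
    congr 1
    refine Finset.sum_congr rfl fun t _ => ?_
    rw [← Matrix.star_eq_conjTranspose, star_mul, star_star]
    simp only [mul_assoc]
  rw [Finset.sum_eq_zero_iff_of_nonneg] at h2
  · exact Matrix.trace_mul_conjTranspose_self_eq_zero_iff.1 (h2 a (Finset.mem_univ _))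
  · intro t _
    exact (Matrix.posSemidef_self_mul_conjTranspose _).trace_nonneg

end EasyQG
namespace EasyQG

open Matrix

set_option linter.all false

section Model4

/-- The block magic unitary-like matrix built from commuting pairs `(q s, v s)`. -/
def bu {S A : Type} [DecidableEq S] [Ring A] (q v : S → A) : S × Bool → S × Bool → A :=
  fun x y => if x.1 = y.1 then (if x.2 = y.2 then q x.1 else 1 - q x.1) * v x.1 else 0

/-- The abstract relations on the pairs `(q s, v s)`. -/
structure BU {S A : Type} [Ring A] [StarRing A] (q v : S → A) : Prop where
  qs : ∀ s, star (q s) = q s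
  qq : ∀ s, q s * q s = q s
  vs : ∀ s, star (v s) = v s
  vv : ∀ s, v s * v s = 1
  qv : ∀ s, v s * q s = q s * v s

variable {S A : Type} [Fintype S] [DecidableEq S] [Ring A] [StarRing A] {q v : S → A}

theorem BU.mul (h : BU q v) (s : S) (c d : A) (hd : v s * d = d * v s) :
    (c * v s) * (d * v s) = c * d := by
  calc _ = c * (v s * d) * v s := by simp only [mul_assoc]
    _ = c * d * (v s * v s) := by rw [hd]; simp only [mul_assoc]
    _ = _ := by rw [h.vv, mul_one]

theorem BU.cm (h : BU q v) (s : S) (a b : Bool) :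
    v s * (if a = b then q s else 1 - q s) = (if a = b then q s else 1 - q s) * v s := by
  split_ifs
  · exact h.qv s
  · rw [mul_sub, sub_mul, h.qv]; simp

theorem BU.st (h : BU q v) (s : S) (a b : Bool) :
    star (if a = b then q s else 1 - q s) = (if a = b then q s else 1 - q s) := by
  split_ifs
  · exact h.qs s
  · rw [star_sub, h.qs]; simp

theorem BU.same (h : BU q v) (s : S) (a a' b b' : Bool) :
    bu q v (s, a) (s, a') * bu q v (s, b) (s, b') =
      (if a = a' then q s else 1 - q s) * (if b = b' then q s else 1 - q s) := by
  simp only [bu, if_true]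
  exact h.mul s _ _ (h.cm s b b')

theorem BU.cc (h : BU q v) (s : S) :
    q s * (1 - q s) = 0 ∧ (1 - q s) * q s = 0 ∧ (1 - q s) * (1 - q s) = 1 - q s := by
  refine ⟨?_, ?_, ?_⟩ <;> simp [mul_sub, sub_mul, h.qq]

theorem BU.orth (h : BU q v) : Orth (bu q v) := by
  refine ⟨?_, ?_, ?_⟩
  · rintro ⟨s, a⟩ ⟨t, b⟩
    simp only [bu]
    split_ifs with h1 h2
    · rw [star_mul, h.qs, h.vs, h.qv]
    · have := h.cm s true false
      have h3 := h.st s true false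
      simp only [Bool.true_eq_false, if_false] at this h3
      rw [star_mul, h3, h.vs, this]
    · simp
  · rintro ⟨s, a⟩ ⟨t, b⟩
    rw [Fintype.sum_prod_type, Finset.sum_eq_single s]
    · by_cases hst : s = t
      · subst hst
        simp only [Fintype.sum_bool, h.same]
        obtain ⟨h1, h2, h3⟩ := h.cc s
        cases a <;> cases b <;> simp [h1, h2, h3, h.qq]
      · have : t ≠ s := fun e => hst e.symm
        simp [bu, hst, this]
    · intro t' _ ht
      have : s ≠ t' := fun e => ht e.symm
      simp [bu, this]
    · simp
  · rintro ⟨s, a⟩ ⟨t, b⟩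
    rw [Fintype.sum_prod_type, Finset.sum_eq_single s]
    · by_cases hst : s = t
      · subst hst
        simp only [Fintype.sum_bool, h.same]
        obtain ⟨h1, h2, h3⟩ := h.cc s
        cases a <;> cases b <;> simp [h1, h2, h3, h.qq]
      · simp [bu, hst]
    · intro t' _ ht
      simp [bu, ht]
    · simp

theorem BU.colz (h : BU q v) (i k j : S × Bool) (hik : i ≠ k) : bu q v i j * bu q v k j = 0 := by
  obtain ⟨s, a⟩ := i
  obtain ⟨t, b⟩ := k
  obtain ⟨r, c⟩ := j
  by_cases h1 : s = r
  · by_cases h2 : t = r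
    · subst h1 h2
      rw [h.same]
      obtain ⟨h1, h2, h3⟩ := h.cc t
      cases a <;> cases b <;> cases c <;> simp_all
    · simp [bu, h2]
  · simp [bu, h1]

theorem BU.sq (h : BU q v) (i j : S × Bool) : bu q v i j * bu q v i j = 0 ∨
    ∃ s, bu q v i j * bu q v i j = q s ∨ bu q v i j * bu q v i j = 1 - q s := by
  obtain ⟨s, a⟩ := i
  obtain ⟨r, c⟩ := j
  by_cases h1 : s = r
  · subst h1
    right
    refine ⟨s, ?_⟩
    rw [h.same]
    obtain ⟨h1, h2, h3⟩ := h.cc s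
    split_ifs
    · left; exact h.qq s
    · right; exact h3
  · left; simp [bu, h1]

theorem BU.cube (h : BU q v) (i j : S × Bool) :
    bu q v i j * (bu q v i j * bu q v i j) = bu q v i j := by
  obtain ⟨s, a⟩ := i
  obtain ⟨r, c⟩ := j
  by_cases h1 : s = r
  · subst h1
    obtain ⟨h1, h2, h3⟩ := h.cc s
    rw [h.same]
    simp only [bu, if_true, mul_assoc]
    have := h.cm s a c
    split_ifs at this ⊢
    · rw [h.qq, h.qv, ← mul_assoc, h.qq]
    · rw [h3, this, ← mul_assoc, h3]
  · simp [bu, h1]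

/-- Conjugation by an entry. -/
theorem BU.conj (h : BU q v) (s : S) (a b : Bool) (x : A) :
    bu q v (s, a) (s, b) * x * bu q v (s, a) (s, b) =
      (if a = b then q s else 1 - q s) * (v s * x * v s) * (if a = b then q s else 1 - q s) := by
  simp only [bu, if_true]
  have := h.cm s a b
  generalize (if a = b then q s else 1 - q s) = c at *
  simp only [mul_assoc]
  rw [this]

end Model4

section Concrete

abbrev M2 := Matrix (Fin 2) (Fin 2) ℝ

noncomputable def e0 : M2 := !![1, 0; 0, 0]
noncomputable def f0 : M2 := !![1/2, 1/2; 1/2, 1/2]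

theorem e0_sq : e0 * e0 = e0 := by
  ext i j; fin_cases i <;> fin_cases j <;> simp [e0, Matrix.mul_apply, Fin.sum_univ_two]
theorem f0_sq : f0 * f0 = f0 := by
  ext i j; fin_cases i <;> fin_cases j <;> simp [f0, Matrix.mul_apply, Fin.sum_univ_two] <;> norm_num
theorem e0_st : e0ᴴ = e0 := by
  ext i j; fin_cases i <;> fin_cases j <;> simp [e0]
theorem f0_st : f0ᴴ = f0 := by
  ext i j; fin_cases i <;> fin_cases j <;> simp [f0]
theorem fe_ne : f0 * e0 * (1 - f0) ≠ 0 := by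
  intro h
  have := congrFun (congrFun h 0) 0
  simp [f0, e0, Matrix.mul_apply, Fin.sum_univ_two] at this
  norm_num at this

variable (M : ℕ)

abbrev Om := Fin 2 × Fin (M + 1)
abbrev AA := Matrix (Om M) (Om M) ℝ
abbrev SS := Fin M ⊕ Bool

abbrev BD (P : Fin (M + 1) → M2) : AA M := Matrix.blockDiagonal P

def sw (j : Fin M) : Equiv.Perm (Fin (M + 1)) := Equiv.swap j.castSucc j.succ

def sg (j : Fin M) : Equiv.Perm (Om M) := Equiv.prodCongr (Equiv.refl _) (sw M j)

noncomputable def vv (j : Fin M) : AA M := (1 : AA M).submatrix (sg M j) id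

theorem sw_sw (j : Fin M) (i : Fin (M + 1)) : sw M j (sw M j i) = i := by
  simp [sw]

theorem sg_sg (j : Fin M) (i : Om M) : sg M j (sg M j i) = i := by
  obtain ⟨a, i⟩ := i
  simp [sg, sw_sw]

theorem vv_apply (j : Fin M) (x y : Om M) : vv M j x y = if sg M j x = y then 1 else 0 := by
  simp [vv, Matrix.one_apply]

theorem vv_conj (j : Fin M) (x : AA M) : vv M j * x * vv M j = x.submatrix (sg M j) (sg M j) := by
  ext a b
  rw [Matrix.mul_apply, Finset.sum_eq_single (sg M j b)]
  · rw [Matrix.mul_apply, Finset.sum_eq_single (sg M j a)]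
    · simp [vv_apply, sg_sg]
    · intro c _ hc
      have : sg M j a ≠ c := fun e => hc e.symm
      simp [vv_apply, this]
    · simp
  · intro c _ hc
    have : sg M j c ≠ b := fun e => hc (by rw [← e, sg_sg])
    simp [vv_apply, this]
  · simp

theorem vv_sq (j : Fin M) : vv M j * vv M j = 1 := by
  have := vv_conj M j 1
  rw [mul_one] at this
  rw [this]
  exact Matrix.submatrix_one_equiv _

theorem vv_st (j : Fin M) : (vv M j)ᴴ = vv M j := by
  ext a b
  have : sg M j b = a ↔ sg M j a = b := by
    constructor <;> rintro rfl <;> exact sg_sg M j _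
  simp [Matrix.conjTranspose_apply, vv_apply, this]

theorem vv_BD (j : Fin M) (P : Fin (M + 1) → M2) :
    vv M j * BD M P * vv M j = BD M (fun i => P (sw M j i)) := by
  rw [vv_conj]
  ext ⟨a, i⟩ ⟨b, k⟩
  simp [Matrix.blockDiagonal_apply, sg]

noncomputable def qS : SS M → AA M
  | Sum.inl _ => 1
  | Sum.inr true => BD M (Pi.single 0 e0)
  | Sum.inr false => BD M (Pi.single (Fin.last M) f0)

noncomputable def vS : SS M → AA M
  | Sum.inl j => vv M j
  | Sum.inr _ => 1

theorem single_mul_single (i : Fin (M + 1)) (a b : M2) :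
    (fun k => (Pi.single i a : Fin (M + 1) → M2) k * (Pi.single i b : Fin (M + 1) → M2) k) =
      Pi.single i (a * b) := by
  funext k
  by_cases h : k = i
  · subst h; simp
  · simp [h]

theorem single_st (i : Fin (M + 1)) (a : M2) :
    (fun k => ((Pi.single i a : Fin (M + 1) → M2) k)ᴴ) = Pi.single i aᴴ := by
  funext k
  by_cases h : k = i
  · subst h; simp
  · simp [h]

theorem bu_ok : BU (qS M) (vS M) := by
  refine ⟨?_, ?_, ?_, ?_, ?_⟩
  · rintro (j | _ | _)
    · exact star_one _
    · simp only [qS, Matrix.star_eq_conjTranspose, BD, Matrix.blockDiagonal_conjTranspose,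
        single_st, f0_st]
    · simp only [qS, Matrix.star_eq_conjTranspose, BD, Matrix.blockDiagonal_conjTranspose,
        single_st, e0_st]
  · rintro (j | _ | _)
    · exact one_mul _
    · simp only [qS, BD, ← Matrix.blockDiagonal_mul, single_mul_single, f0_sq]
    · simp only [qS, BD, ← Matrix.blockDiagonal_mul, single_mul_single, e0_sq]
  · rintro (j | _)
    · exact vv_st M j
    · exact star_one _
  · rintro (j | _)
    · exact vv_sq M j
    · exact one_mul _
  · rintro (j | _)
    · simp [qS]
    · simp [vS]

/-- The light cone subspaces. -/
def JJ (n : ℕ) : Set (AA M) := {x | ∃ P : Fin (M + 1) → M2, x = BD M P ∧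
  (∀ i : Fin (M + 1), i.1 + n < M → P i * e0 = e0 * P i) ∧
  (∀ i : Fin (M + 1), n < i.1 → P i * f0 = f0 * P i)}

theorem one_JJ : (1 : AA M) ∈ JJ M 0 :=
  ⟨1, Matrix.blockDiagonal_one.symm, by simp, by simp⟩

theorem zero_JJ (n : ℕ) : (0 : AA M) ∈ JJ M n :=
  ⟨0, Matrix.blockDiagonal_zero.symm, by simp, by simp⟩

theorem JJ_succ {n : ℕ} {x : AA M} (h : x ∈ JJ M n) : x ∈ JJ M (n + 1) := by
  obtain ⟨P, h1, h2, h3⟩ := h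
  exact ⟨P, h1, fun i hi => h2 i (by omega), fun i hi => h3 i (by omega)⟩

theorem JJ_mul {n : ℕ} {x y : AA M} (hx : x ∈ JJ M n) (hy : y ∈ JJ M n) : x * y ∈ JJ M n := by
  obtain ⟨P, rfl, h2, h3⟩ := hx
  obtain ⟨Q, rfl, h4, h5⟩ := hy
  refine ⟨fun i => P i * Q i, by simp only [BD, Matrix.blockDiagonal_mul], ?_, ?_⟩
  · intro i hi
    rw [mul_assoc, h4 i hi, ← mul_assoc, h2 i hi, mul_assoc]
  · intro i hi
    rw [mul_assoc, h5 i hi, ← mul_assoc, h3 i hi, mul_assoc]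

theorem JJ_sub {n : ℕ} {x : AA M} (hx : x ∈ JJ M n) : 1 - x ∈ JJ M n := by
  obtain ⟨P, rfl, h2, h3⟩ := hx
  refine ⟨fun i => 1 - P i, ?_, ?_, ?_⟩
  · rw [← Matrix.blockDiagonal_one, BD, BD, ← Matrix.blockDiagonal_sub]; rfl
  · intro i hi
    rw [sub_mul, mul_sub, h2 i hi]; simp
  · intro i hi
    rw [sub_mul, mul_sub, h3 i hi]; simp

theorem q_JJ (n : ℕ) (s : SS M) : qS M s ∈ JJ M n := by
  rcases s with (j | _ | _)
  · exact ⟨1, Matrix.blockDiagonal_one.symm, by simp, by simp⟩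
  · refine ⟨_, rfl, ?_, ?_⟩
    · intro i hi
      have : i ≠ Fin.last M := by rintro rfl; simp at hi
      simp [this]
    · intro i hi
      by_cases h : i = Fin.last M
      · subst h; simp
      · simp [h]
  · refine ⟨_, rfl, ?_, ?_⟩
    · intro i hi
      by_cases h : i = 0
      · subst h; simp
      · simp [h]
    · intro i hi
      have : i ≠ 0 := by rintro rfl; simp at hi
      simp [this]

theorem JJ_comm {n : ℕ} (hn : n < M) {x : AA M} (hx : x ∈ JJ M n) (s : SS M) :
    x * qS M s = qS M s * x := by
  obtain ⟨P, rfl, h2, h3⟩ := hx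
  rcases s with (j | _ | _)
  · simp [qS]
  · simp only [qS, BD, ← Matrix.blockDiagonal_mul]
    congr 1
    funext k
    by_cases h : k = Fin.last M
    · subst h; simpa using h3 (Fin.last M) (by simpa using hn)
    · simp [h]
  · simp only [qS, BD, ← Matrix.blockDiagonal_mul]
    congr 1
    funext k
    by_cases h : k = 0
    · subst h; simpa using h2 0 (by simpa using hn)
    · simp [h]

theorem JJ_vconj {n : ℕ} {x : AA M} (hx : x ∈ JJ M n) (j : Fin M) :
    vv M j * x * vv M j ∈ JJ M (n + 1) := by
  obtain ⟨P, rfl, h2, h3⟩ := hx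
  refine ⟨_, vv_BD M j P, ?_, ?_⟩
  · intro i hi
    apply h2
    have : (sw M j i).1 ≤ i.1 + 1 := by
      simp only [sw, Equiv.swap_apply_def]
      split_ifs with h1 h2 <;> simp_all <;> omega
    omega
  · intro i hi
    apply h3
    have : i.1 ≤ (sw M j i).1 + 1 := by
      simp only [sw, Equiv.swap_apply_def]
      split_ifs with h1 h2 <;> simp_all <;> omega
    omega

theorem JJ_bu {n : ℕ} {x : AA M} (hx : x ∈ JJ M n) (i b : SS M × Bool) :
    bu (qS M) (vS M) i b * x * bu (qS M) (vS M) i b ∈ JJ M (n + 1) := by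
  obtain ⟨s, a⟩ := i
  obtain ⟨t, b⟩ := b
  by_cases h : s = t
  · subst h
    rw [(bu_ok M).conj]
    have h1 : vS M s * x * vS M s ∈ JJ M (n + 1) := by
      rcases s with (j | c)
      · exact JJ_vconj M hx j
      · simp only [vS, one_mul, mul_one]; exact JJ_succ M hx
    have h2 : (if a = b then qS M s else 1 - qS M s) ∈ JJ M (n + 1) := by
      split_ifs
      · exact q_JJ M _ s
      · exact JJ_sub M (q_JJ M _ s)
    exact JJ_mul M (JJ_mul M h2 h1) h2
  · simp only [bu, h, if_false, zero_mul]; exact zero_JJ M _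

theorem UU_conj {n : ℕ} (x y a : Fin (n + 1) → SS M × Bool) :
    UU (bu (qS M) (vS M)) (n + 1) x a * star (UU (bu (qS M) (vS M)) (n + 1) y a) =
    bu (qS M) (vS M) (x 0) (a 0) * (UU (bu (qS M) (vS M)) n (Fin.tail x) (Fin.tail a) *
      star (UU (bu (qS M) (vS M)) n (Fin.tail y) (Fin.tail a))) *
      bu (qS M) (vS M) (y 0) (a 0) := by
  rw [UU_cons, UU_cons, star_mul, (bu_ok M).orth.sa]
  simp only [mul_assoc]

theorem UU_JJ : ∀ (n : ℕ) (x a : Fin n → SS M × Bool),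
    UU (bu (qS M) (vS M)) n x a * star (UU (bu (qS M) (vS M)) n x a) ∈ JJ M n
  | 0, x, a => by
    have : UU (bu (qS M) (vS M)) 0 x a = 1 := by simp [UU]
    rw [this, star_one, mul_one]
    exact one_JJ M
  | n + 1, x, a => by
    rw [UU_conj]
    exact JJ_bu M (UU_JJ n _ _) _ _

theorem lvl : Lvl M (bu (qS M) (vS M)) where
  toOrth := (bu_ok M).orth
  colz := (bu_ok M).colz
  cube := (bu_ok M).cube
  comm := by
    intro n hn x a i b
    have h := UU_JJ M n x a
    rcases (bu_ok M).sq i b with h0 | ⟨s, h0 | h0⟩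
    · rw [h0]; simp
    · rw [h0]; exact JJ_comm M hn h s
    · rw [h0, mul_sub, sub_mul, JJ_comm M hn h s]; simp

theorem cone_word : ∀ (n : ℕ) (hn : n ≤ M), ∃ x : Fin (n + 1) → SS M × Bool,
    UU (bu (qS M) (vS M)) (n + 1) x x * star (UU (bu (qS M) (vS M)) (n + 1) x x) =
      BD M (Pi.single ⟨n, by omega⟩ e0)
  | 0, hn => by
    refine ⟨fun _ => (Sum.inr true, true), ?_⟩
    rw [UU_conj, (bu_ok M).conj]
    have : UU (bu (qS M) (vS M)) 0 (Fin.tail fun _ => (Sum.inr true, true))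
      (Fin.tail fun _ => (Sum.inr true, true)) = 1 := by simp [UU]
    rw [this, star_one]
    have h := (bu_ok M).qq (Sum.inr true)
    simp only [vS, if_true, mul_one]
    exact h
  | n + 1, hn => by
    obtain ⟨x, hx⟩ := cone_word n (by omega)
    refine ⟨Fin.cons (Sum.inl ⟨n, by omega⟩, true) x, ?_⟩
    rw [UU_conj, Fin.cons_zero, (bu_ok M).conj, Fin.tail_cons, hx]
    simp only [if_true, qS, vS, one_mul, mul_one]
    rw [vv_BD]
    congr 1
    funext i
    by_cases h : i = ⟨n + 1, by omega⟩
    · subst h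
      have : sw M ⟨n, by omega⟩ ⟨n + 1, by omega⟩ = ⟨n, by omega⟩ :=
        Equiv.swap_apply_right _ _
      rw [this]; simp
    · have : sw M ⟨n, by omega⟩ i ≠ ⟨n, by omega⟩ := by
        intro e
        apply h
        rw [← sw_sw M ⟨n, by omega⟩ i, e]
        exact Equiv.swap_apply_left _ _
      simp [h, this]

theorem not_pi : ¬ RR (bu (qS M) (vS M)) (piPartition (M + 2)) := by
  intro hR
  obtain ⟨w, hw⟩ := cone_word M M le_rfl
  have := pi_zero (bu_ok M).orth hR (Fin.cons (Sum.inr false, true) w)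
    (Fin.cons (Sum.inr false, false) w) (Fin.cons (Sum.inr false, true) w) (by
      intro h
      have := congrFun h 0
      simp at this)
  rw [UU_conj] at this
  simp only [Fin.cons_zero, Fin.tail_cons] at this
  rw [hw] at this
  simp only [bu, if_true, vS, mul_one, qS, Bool.false_eq_true, if_false] at this
  rw [mul_sub, mul_one] at this
  simp only [BD, ← Matrix.blockDiagonal_mul, ← Matrix.blockDiagonal_sub] at this
  rw [← Matrix.blockDiagonal_zero] at this
  replace this := Matrix.blockDiagonal_injective this
  have h := congrFun this (Fin.last M)
  have e : (⟨M, by omega⟩ : Fin (M + 1)) = Fin.last M := rfl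
  rw [e] at h
  simp only [Pi.sub_apply, Pi.single_eq_same, Pi.zero_apply] at h
  apply fe_ne
  rw [mul_sub, mul_one]
  exact h

end Concrete

theorem exists_cat (K : ℕ) : ∃ C : PartitionCategory, piUpTo K ⊆ C.mem ∧
    ∃ k, 1 ≤ k ∧ (⟨0, 4 * k, piPartition k⟩ : Σ k l : ℕ, Partition k l) ∉ C.mem := by
  refine ⟨modelCat (u := bu (qS K) (vS K)) ?_ (bu_ok K).orth, ?_, K + 2, by omega, not_pi K⟩
  · intro n hn a ha
    ext x y
    have := congrFun (congrFun ha x) y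
    rw [Matrix.smul_apply, nsmul_eq_mul] at this
    simpa [hn] using this
  · rintro _ ⟨l, h1, h2, rfl⟩
    exact (lvl K).RR_pi h2

theorem piUpTo_mono {K K' : ℕ} (h : K ≤ K') : piUpTo K ⊆ piUpTo K' := by
  rintro _ ⟨l, h1, h2, rfl⟩
  exact ⟨l, h1, h2.trans h, rfl⟩

/-- The union of the categories generated by finitely many `π_l`. -/
def unionCat : PartitionCategory where
  mem := {x | ∃ K, ∀ C : PartitionCategory, piUpTo K ⊆ C.mem → x ∈ C.mem}
  id_mem := ⟨0, fun C _ => C.id_mem⟩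
  tensor_mem := by
    rintro _ _ _ _ _ _ ⟨K, h⟩ ⟨K', h'⟩
    exact ⟨max K K', fun C hC => C.tensor_mem
      (h C ((piUpTo_mono (le_max_left _ _)).trans hC))
      (h' C ((piUpTo_mono (le_max_right _ _)).trans hC))⟩
  comp_mem := by
    rintro _ _ _ _ _ ⟨K, h⟩ ⟨K', h'⟩
    exact ⟨max K K', fun C hC => C.comp_mem
      (h C ((piUpTo_mono (le_max_left _ _)).trans hC))
      (h' C ((piUpTo_mono (le_max_right _ _)).trans hC))⟩
  involution_mem := fun ⟨K, h⟩ => ⟨K, fun C hC => C.involution_mem (h C hC)⟩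
  rotUL_mem := fun ⟨K, h⟩ => ⟨K, fun C hC => C.rotUL_mem (h C hC)⟩
  rotLU_mem := fun ⟨K, h⟩ => ⟨K, fun C hC => C.rotLU_mem (h C hC)⟩
  rotUR_mem := fun ⟨K, h⟩ => ⟨K, fun C hC => C.rotUR_mem (h C hC)⟩
  rotRU_mem := fun ⟨K, h⟩ => ⟨K, fun C hC => C.rotRU_mem (h C hC)⟩

theorem piAll_sub : piAll ⊆ unionCat.mem := by
  rintro _ ⟨l, h1, rfl⟩
  exact ⟨l, fun C hC => hC ⟨l, h1, le_rfl, rfl⟩⟩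

theorem list_bound (L : List (Σ k l : ℕ, Partition k l)) (h : ∀ x ∈ L, x ∈ unionCat.mem) :
    ∃ K, ∀ C : PartitionCategory, piUpTo K ⊆ C.mem → ∀ x ∈ L, x ∈ C.mem := by
  induction L with
  | nil => exact ⟨0, by simp⟩
  | cons y L ih =>
    obtain ⟨K, hK⟩ := ih (fun x hx => h x (List.mem_cons_of_mem _ hx))
    obtain ⟨K', hK'⟩ := h y List.mem_cons_self
    refine ⟨max K K', fun C hC x hx => ?_⟩
    rcases List.mem_cons.mp hx with rfl | hx
    · exact hK' C ((piUpTo_mono (le_max_right _ _)).trans hC)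
    · exact hK C ((piUpTo_mono (le_max_left _ _)).trans hC) x hx

end EasyQG

namespace EasyQG

theorem statement17 :
    ¬ ∃ L : List (Σ k l : ℕ, Partition k l), generated piAll = generated {x | x ∈ L} := by
  rintro ⟨L, hL⟩
  obtain ⟨K, hK⟩ := list_bound L (fun x hx => by
    have : x ∈ generated piAll := by
      rw [hL]
      exact fun C hC => hC hx
    exact this unionCat piAll_sub)
  obtain ⟨C, hC, k, hk, hn⟩ := exists_cat K
  apply hn
  have : (⟨0, 4 * k, piPartition k⟩ : Σ k l : ℕ, Partition k l) ∈ generated piAll :=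
    fun D hD => hD ⟨k, hk, rfl⟩
  rw [hL] at this
  exact this C (fun x hx => hK C hC x hx)

end EasyQG
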